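/- Let R be a complete regular local ring of prime characteristic p > 0 and let g ∈ R. Then the set of F-jumping coefficients of the principal ideal (g) has no accumulation point of the form a/(p^d(p^β − 1)) with a, d, β integers, a ≥ 0, d ≥ 0 and β ≥ 1. -/

import Mathlib

/-- The `q`-th bracket power of an ideal: the ideal generated by the `q`-th powers
of the elements of `J`. -/
def bracketPow {R : Type*} [CommRing R] (J : Ideal R) (q : ℕ) : Ideal R :=
  Ideal.span ((fun x => x ^ q) '' (J : Set R))

/-- `Ie p a e` is the intersection of all ideals `I` with `a ⊆ I^{[p^e]}`. -/
def Ie {R : Type*} [CommRing R] (p : ℕ) (a : Ideal R) (e : ℕ) : Ideal R :=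
  sInf {I : Ideal R | a ≤ bracketPow I (p ^ e)}

/-- Condition (*): `a ⊆ I_e(a)^{[p^e]}` for every ideal `a` and every `e ≥ 1`. -/
def CondStar (R : Type*) [CommRing R] (p : ℕ) : Prop :=
  ∀ (a : Ideal R) (e : ℕ), 1 ≤ e → a ≤ bracketPow (Ie p a e) (p ^ e)

/-- The generalized test ideal `τ(a^c)`: the supremum, in the lattice of ideals of `R`,
of the ideals `I_e(a^{⌈c p^e⌉})` for `e ≥ 1`. -/
noncomputable def tau {R : Type*} [CommRing R] (p : ℕ) (a : Ideal R) (c : ℝ) : Ideal R :=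
  ⨆ e : {e : ℕ // 1 ≤ e}, Ie p (a ^ ⌈c * (p : ℝ) ^ (e : ℕ)⌉₊) (e : ℕ)

/-- `c > 0` is an F-jumping coefficient of `a` if `τ(a^c) ≠ τ(a^{c-ε})` for all
`0 < ε < c`. -/
def IsFJumpingCoeff {R : Type*} [CommRing R] (p : ℕ) (a : Ideal R) (c : ℝ) : Prop :=
  0 < c ∧ ∀ ε : ℝ, 0 < ε → ε < c → tau p a c ≠ tau p a (c - ε)

/-- `x` is an accumulation point of `S ⊆ ℝ`. -/
def IsAccumulationPt (S : Set ℝ) (x : ℝ) : Prop :=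
  ∀ ε : ℝ, 0 < ε → ∃ y ∈ S, y ≠ x ∧ |y - x| < ε

/-- `R` is a regular local ring: Noetherian, local, and the maximal ideal is generated
by `dim R` elements. -/
def IsRegularStmt (R : Type*) [CommRing R] [IsLocalRing R] : Prop :=
  ∃ s : Finset R, IsLocalRing.maximalIdeal R = Ideal.span (s : Set R) ∧
    (s.card : WithBot (WithTop ℕ)) = ringKrullDim R

section helpers
open IsLocalRing



theorem aux_quot_local {R : Type*} [CommRing R] [IsLocalRing R] (I : Ideal R)
    (hI : I ≤ maximalIdeal R) : IsLocalRing (R ⧸ I) := by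
  have : Nontrivial (R ⧸ I) := Ideal.Quotient.nontrivial_iff.mpr
    (fun h => (maximalIdeal.isMaximal R).ne_top (top_le_iff.mp (h ▸ hI)))
  exact IsLocalRing.of_surjective' (Ideal.Quotient.mk I) Ideal.Quotient.mk_surjective

theorem aux_quot_max {R : Type*} [CommRing R] [IsLocalRing R] (I : Ideal R)
    [IsLocalRing (R ⧸ I)] (U : Set R) (h : maximalIdeal R = I ⊔ Ideal.span U) :
    maximalIdeal (R ⧸ I) = Ideal.span (Ideal.Quotient.mk I '' U) := by
  have hs : Function.Surjective (Ideal.Quotient.mk I) := Ideal.Quotient.mk_surjective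
  have h1 : (maximalIdeal R).map (Ideal.Quotient.mk I) = maximalIdeal (R ⧸ I) := by
    rcases Ideal.map_eq_top_or_isMaximal_of_surjective (Ideal.Quotient.mk I) hs
      (maximalIdeal.isMaximal R) with h2 | h2
    · exfalso
      have h3 := Ideal.comap_map_of_surjective _ hs (maximalIdeal R)
      rw [h2, Ideal.comap_top, ← RingHom.ker_eq_comap_bot, Ideal.mk_ker] at h3
      have : I ≤ maximalIdeal R := h ▸ le_sup_left
      rw [sup_eq_left.mpr this] at h3
      exact (maximalIdeal.isMaximal R).ne_top h3.symm
    · exact IsLocalRing.eq_maximalIdeal h2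
  rw [← h1, h, Ideal.map_sup, Ideal.map_span, Ideal.map_quotient_self, bot_sup_eq]

theorem aux_cancel (n : ℕ) (D : WithBot ℕ∞) (h : (n : WithBot ℕ∞) + 1 ≤ D + 1) :
    (n : WithBot ℕ∞) ≤ D := by
  induction D using WithBot.recBotCoe with
  | bot => exact absurd h (by rw [WithBot.bot_add, not_le]; exact WithBot.bot_lt_coe ((n : ℕ∞) + 1))
  | coe D =>
    induction D using ENat.recTopCoe with
    | top => exact WithBot.coe_le_coe.mpr le_top
    | coe m =>
      have h' : n + 1 ≤ m + 1 := by exact_mod_cast h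
      have : n ≤ m := by omega
      exact_mod_cast this

theorem aux_domain : ∀ (n : ℕ) (R : Type u) [CommRing R] [IsNoetherianRing R] [IsLocalRing R]
    (s : Finset R), s.card ≤ n → maximalIdeal R = Ideal.span (s : Set R) →
    ((n : ℕ) : WithBot ℕ∞) ≤ ringKrullDim R → IsDomain R := by
  classical
  intro n
  induction n with
  | zero =>
    intro R _ _ _ s hs hm _
    have : s = ∅ := Finset.card_eq_zero.mp (Nat.le_zero.mp hs)
    subst this
    have h0 : maximalIdeal R = ⊥ := by rw [hm]; simp
    exact (IsLocalRing.isField_iff_maximalIdeal_eq.mpr h0).isDomain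
  | succ n ih =>
    intro R _ _ _ s hs hm hd
    -- m is not a minimal prime and m ≠ m^2
    have hht : ((n + 1 : ℕ) : ℕ∞) ≤ (maximalIdeal R).height := by
      have := IsLocalRing.maximalIdeal_height_eq_ringKrullDim (R := R)
      rw [← this] at hd
      exact_mod_cast hd
    have hmin : ∀ P ∈ minimalPrimes R, ¬ maximalIdeal R ≤ P := by
      intro P hP hle
      have hPp : P.IsPrime := hP.1.1
      have : P = maximalIdeal R := le_antisymm (IsLocalRing.le_maximalIdeal hPp.ne_top) hle
      subst this
      have h0 : (maximalIdeal R).height = 0 := by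
        rw [Ideal.height_eq_zero_iff]; exact hP
      rw [h0] at hht
      simp at hht
    have hsq : ¬ maximalIdeal R ≤ maximalIdeal R ^ 2 := by
      intro hle
      have h0 : maximalIdeal R = ⊥ := by
        apply Submodule.eq_bot_of_le_smul_of_le_jacobson_bot (maximalIdeal R) (maximalIdeal R)
          (IsNoetherian.noetherian _)
        · rw [smul_eq_mul, ← sq]; exact hle
        · exact IsLocalRing.maximalIdeal_le_jacobson _
      have := (IsLocalRing.isField_iff_maximalIdeal_eq.mpr h0)
      have hdim := ringKrullDim_eq_zero_of_isField this
      rw [hdim] at hd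
      have : n + 1 ≤ 0 := by exact_mod_cast hd
      omega
    have hfin := minimalPrimes.finite_of_isNoetherianRing R
    obtain ⟨x, hxm, hx⟩ : ∃ x ∈ maximalIdeal R, x ∉ maximalIdeal R ^ 2 ∧
        ∀ P ∈ minimalPrimes R, x ∉ P := by
      by_contra hcon
      push Not at hcon
      have := (Ideal.subset_union_prime (s := insert (maximalIdeal R ^ 2) hfin.toFinset)
        (f := fun I : Ideal R => I) (maximalIdeal R ^ 2) (maximalIdeal R ^ 2)
        (I := maximalIdeal R) (by
          intro i hi h1 _
          rcases Finset.mem_insert.mp hi with h | h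
          · exact absurd h h1
          · exact ((hfin.mem_toFinset).mp h).1.1)).mp (by
          intro x hx
          by_cases h2 : x ∈ maximalIdeal R ^ 2
          · simp only [Set.mem_iUnion]
            exact ⟨_, by simp, h2⟩
          · obtain ⟨P, hP, hxP⟩ := hcon x hx h2
            simp only [Set.mem_iUnion]
            exact ⟨P, by simp [hP], hxP⟩)
      obtain ⟨i, hi, hle⟩ := this
      rcases Finset.mem_insert.mp hi with h | h
      · exact hsq (h ▸ hle)
      · exact hmin _ ((hfin.mem_toFinset).mp h) hle
    obtain ⟨hx2, hxP⟩ := hx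
    -- exchange
    obtain ⟨y, hys, hy⟩ : ∃ y ∈ s, maximalIdeal R =
        Ideal.span {x} ⊔ Ideal.span ((s.erase y : Finset R) : Set R) := by
      have hxs := hxm
      rw [hm, Submodule.mem_span_finset] at hxs
      obtain ⟨f, -, hf⟩ := hxs
      by_contra hcon
      push Not at hcon
      apply hx2
      rw [← hf]
      refine Ideal.sum_mem _ fun y hy => ?_
      have hym : y ∈ maximalIdeal R := hm ▸ Ideal.subset_span hy
      have hfm : f y ∈ maximalIdeal R := by
        rw [IsLocalRing.mem_maximalIdeal, mem_nonunits_iff]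
        intro hu
        apply hcon y hy
        apply le_antisymm
        · rw [hm, Ideal.span_le]
          intro z hz
          by_cases hzy : z = y
          · subst hzy
            rw [← Finset.add_sum_erase _ _ hy] at hf
            have h3 : f z * z ∈ Ideal.span {x} ⊔ Ideal.span ((s.erase z : Finset R) : Set R) := by
              have : f z * z = x - ∑ w ∈ s.erase z, f w • w := by rw [← hf]; simp
              rw [this]
              refine Ideal.sub_mem _ (Ideal.mem_sup_left (Ideal.mem_span_singleton_self x))
                (Ideal.mem_sup_right (Ideal.sum_mem _ fun w hw => ?_))
              exact Ideal.mul_mem_left _ _ (Ideal.subset_span hw)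
            exact (Ideal.unit_mul_mem_iff_mem _ hu).mp h3
          · exact Ideal.mem_sup_right (Ideal.subset_span (by
              simp only [Finset.coe_erase]
              exact ⟨hz, hzy⟩))
        · refine sup_le ?_ ?_
          · rw [Ideal.span_singleton_le_iff_mem]; exact hxm
          · rw [hm]; exact Ideal.span_mono (by simp)
      rw [sq]
      exact Ideal.mul_mem_mul hfm hym
    have hIm : Ideal.span {x} ≤ maximalIdeal R := by
      rw [Ideal.span_singleton_le_iff_mem]; exact hxm
    have := aux_quot_local (Ideal.span {x}) hIm
    have hmax := aux_quot_max (Ideal.span {x}) _ hy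
    have hle : ((n + 1 : ℕ) : WithBot ℕ∞) ≤ ringKrullDim (R ⧸ Ideal.span {x}) + 1 := by
      refine hd.trans ?_
      have := ringKrullDim_le_ringKrullDim_quotient_add_card ({x} : Finset R) (by
        rw [IsLocalRing.ringJacobson_eq_maximalIdeal]; simpa using hxm)
      rw [Finset.coe_singleton] at this
      simpa using this
    have hle' : ((n : ℕ) : WithBot ℕ∞) ≤ ringKrullDim (R ⧸ Ideal.span {x}) := by
      rw [Nat.cast_add, Nat.cast_one] at hle
      exact aux_cancel n _ hle
    have hcard : ((s.erase y).image (Ideal.Quotient.mk (Ideal.span {x}))).card ≤ n := by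
      refine Finset.card_image_le.trans ?_
      rw [Finset.card_erase_of_mem hys]; omega
    have hdom : IsDomain (R ⧸ Ideal.span {x}) := ih _ _ hcard (by
      rw [hmax, Finset.coe_image]) hle'
    have hprime : (Ideal.span {x}).IsPrime := (Ideal.Quotient.isDomain_iff_prime _).mp hdom
    obtain ⟨P, hP, hPle⟩ := Ideal.exists_minimalPrimes_le (bot_le : ⊥ ≤ Ideal.span {x})
    have hPp : P.IsPrime := hP.1.1
    have hP0 : P = ⊥ := by
      apply Submodule.eq_bot_of_le_smul_of_le_jacobson_bot (Ideal.span {x}) P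
          (IsNoetherian.noetherian _)
      · intro z hz
        obtain ⟨w, rfl⟩ := Ideal.mem_span_singleton.mp (hPle hz)
        have hw : w ∈ P := (hPp.mem_or_mem hz).resolve_left (hxP P hP)
        exact Ideal.mul_mem_mul (Ideal.mem_span_singleton_self x) hw
      · exact hIm.trans (IsLocalRing.maximalIdeal_le_jacobson _)
    subst hP0
    exact (IsDomain.of_bot_isPrime R)

/-- elementwise non-zero-divisor modulo an ideal -/
def RegMod {R : Type*} [CommRing R] (L : Ideal R) (x : R) : Prop := ∀ r, x * r ∈ L → r ∈ L

theorem aux_prime {R : Type*} [CommRing R] [IsNoetherianRing R] [IsLocalRing R]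
    (s : Finset R) (hm : maximalIdeal R = Ideal.span (s : Set R))
    (hd : (s.card : WithBot ℕ∞) ≤ ringKrullDim R) (T : Finset R) (hT : T ⊆ s) :
    (Ideal.span (T : Set R)).IsPrime := by
  classical
  have hTm : Ideal.span (T : Set R) ≤ maximalIdeal R := hm ▸ Ideal.span_mono (by exact_mod_cast hT)
  have := aux_quot_local _ hTm
  have h1 : maximalIdeal R = Ideal.span (T : Set R) ⊔ Ideal.span ((s \ T : Finset R) : Set R) := by
    rw [hm, ← Ideal.span_union, ← Finset.coe_union, Finset.union_sdiff_of_subset hT]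
  have hmax := aux_quot_max _ _ h1
  have hdim : ((s \ T).card : WithBot ℕ∞) ≤ ringKrullDim (R ⧸ Ideal.span (T : Set R)) := by
    have h2 := ringKrullDim_le_ringKrullDim_quotient_add_card T (by
        rw [IsLocalRing.ringJacobson_eq_maximalIdeal]
        exact fun z hz => hTm (Ideal.subset_span hz))
    have h3 := hd.trans h2
    have h4 : s.card = (s \ T).card + T.card := by
      rw [Finset.card_sdiff_add_card_eq_card hT]
    rw [h4, Nat.cast_add] at h3
    generalize T.card = k at h3
    generalize ringKrullDim (R ⧸ Ideal.span (T : Set R)) = D at h3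
    clear h4 h2
    induction k with
    | zero => simpa using h3
    | succ k ih =>
      apply ih
      have := aux_cancel ((s \ T).card + k) (D + k)
      push_cast at this h3
      apply this
      rwa [add_assoc, add_assoc]
  have hdom : IsDomain (R ⧸ Ideal.span (T : Set R)) :=
    aux_domain (s \ T).card _ ((s \ T).image (Ideal.Quotient.mk _)) Finset.card_image_le
      (by rw [hmax, Finset.coe_image]) hdim
  exact (Ideal.Quotient.isDomain_iff_prime _).mp hdom

theorem aux_notMem {R : Type*} [CommRing R] [IsNoetherianRing R] [IsLocalRing R]
    (s : Finset R) (hm : maximalIdeal R = Ideal.span (s : Set R))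
    (hd : (s.card : WithBot ℕ∞) ≤ ringKrullDim R) (T : Finset R) (hT : T ⊆ s)
    (x : R) (hx : x ∈ s) (hxT : x ∉ T) : x ∉ Ideal.span (T : Set R) := by
  classical
  intro hcon
  have h1 : maximalIdeal R = Ideal.span ((s.erase x : Finset R) : Set R) := by
    apply le_antisymm
    · rw [hm, Ideal.span_le]
      intro z hz
      by_cases hzx : z = x
      · subst hzx
        refine Ideal.span_mono ?_ hcon
        intro w hw
        simp only [Finset.coe_erase]
        exact ⟨hT hw, fun h => hxT (h ▸ hw)⟩
      · exact Ideal.subset_span (by simp only [Finset.coe_erase]; exact ⟨hz, hzx⟩)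
    · rw [hm]; exact Ideal.span_mono (by simp)
  have h2 := ringKrullDim_le_spanFinrank_maximalIdeal R
  have h3 : (maximalIdeal R).spanFinrank ≤ (s.erase x).card := by
    rw [h1, ← Set.ncard_coe_finset]
    exact Submodule.spanFinrank_span_le_ncard_of_finite (Finset.finite_toSet _)
  have h4 := hd.trans h2
  have h5 : s.card ≤ (maximalIdeal R).spanFinrank := by exact_mod_cast h4
  rw [Finset.card_erase_of_mem hx] at h3
  have : 0 < s.card := Finset.card_pos.mpr ⟨x, hx⟩
  omega

theorem aux_regMod {R : Type*} [CommRing R] [IsNoetherianRing R] [IsLocalRing R]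
    (s : Finset R) (hm : maximalIdeal R = Ideal.span (s : Set R))
    (hd : (s.card : WithBot ℕ∞) ≤ ringKrullDim R) (T : Finset R) (hT : T ⊆ s)
    (x : R) (hx : x ∈ s) (hxT : x ∉ T) : RegMod (Ideal.span (T : Set R)) x := fun _ hr =>
  ((aux_prime s hm hd T hT).mem_or_mem hr).resolve_left (aux_notMem s hm hd T hT x hx hxT)

theorem RegMod.pow {R : Type*} [CommRing R] {L : Ideal R} {x : R} (h : RegMod L x) (n : ℕ) :
    RegMod L (x ^ n) := by
  induction n with
  | zero => intro r hr; simpa using hr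
  | succ n ih => intro r hr; rw [pow_succ, mul_assoc] at hr; exact h _ (ih _ hr)

theorem RegMod.swap {R : Type*} [CommRing R] {L : Ideal R} {x y : R} (hy : RegMod L y)
    (hx : RegMod (L ⊔ Ideal.span {y}) x) (n : ℕ) :
    RegMod (L ⊔ Ideal.span {y ^ n}) x := by
  induction n with
  | zero => intro r _; simp
  | succ n ih =>
    intro r hr
    have h1 : r ∈ L ⊔ Ideal.span {y ^ n} := by
      apply ih
      refine sup_le_sup_left ?_ L hr
      rw [Ideal.span_singleton_le_span_singleton]
      exact pow_dvd_pow _ (by omega)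
    obtain ⟨l, hl, w, hw, rfl⟩ := Submodule.mem_sup.mp h1
    obtain ⟨s, rfl⟩ := Ideal.mem_span_singleton.mp hw
    obtain ⟨l', hl', w', hw', he⟩ := Submodule.mem_sup.mp hr
    obtain ⟨t, rfl⟩ := Ideal.mem_span_singleton.mp hw'
    have h2 : x * s - y * t ∈ L := by
      apply hy.pow n
      have : y ^ n * (x * s - y * t) = l' - x * l := by
        linear_combination -he
      rw [this]
      exact L.sub_mem hl' (L.mul_mem_left _ hl)
    have h3 : s ∈ L ⊔ Ideal.span {y} := by
      apply hx
      have : x * s = (x * s - y * t) + y * t := by ring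
      rw [this]
      exact Submodule.add_mem_sup h2 (Ideal.mem_span_singleton.mpr (dvd_mul_right _ _))
    obtain ⟨l₂, hl₂, w₂, hw₂, rfl⟩ := Submodule.mem_sup.mp h3
    obtain ⟨u, rfl⟩ := Ideal.mem_span_singleton.mp hw₂
    have : l + y ^ n * (l₂ + y * u) = (l + y ^ n * l₂) + y ^ (n + 1) * u := by ring
    rw [this]
    exact Submodule.add_mem_sup (L.add_mem hl (L.mul_mem_left _ hl₂))
      (Ideal.mem_span_singleton.mpr (dvd_mul_right _ _))

/-- colength -/
noncomputable def ilen {R : Type*} [CommRing R] (I : Ideal R) : ℕ∞ := Module.length R (R ⧸ I)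

/-- colon by an element -/
def cln {R : Type*} [CommRing R] (I : Ideal R) (c : R) : Ideal R :=
  Submodule.comap (LinearMap.lsmul R R c) I

theorem mem_cln {R : Type*} [CommRing R] {I : Ideal R} {c r : R} : r ∈ cln I c ↔ c * r ∈ I :=
  Iff.rfl

theorem ilen_anti {R : Type*} [CommRing R] {I J : Ideal R} (h : I ≤ J) : ilen J ≤ ilen I :=
  Module.length_le_of_surjective (Submodule.factor h) (Submodule.factor_surjective h)

theorem ilen_top {R : Type*} [CommRing R] : ilen (⊤ : Ideal R) = 0 := by
  have : Subsingleton (R ⧸ (⊤ : Ideal R)) := Ideal.Quotient.subsingleton_iff.mpr rfl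
  exact Module.length_eq_zero

theorem ilen_split {R : Type*} [CommRing R] (I : Ideal R) (c : R) :
    ilen I = ilen (cln I c) + ilen (I ⊔ Ideal.span {c}) := by
  have hle : cln I c ≤ Submodule.comap (LinearMap.lsmul R R c) I := fun _ h => h
  refine Module.length_eq_add_of_exact (R := R)
    (Submodule.mapQ (cln I c) I (LinearMap.lsmul R R c) hle)
    (Submodule.factor (le_sup_left : I ≤ I ⊔ Ideal.span {c})) ?_
    (Submodule.factor_surjective _) ?_
  · rw [← LinearMap.ker_eq_bot]
    exact Submodule.ker_liftQ_eq_bot _ _ _ (by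
      intro r hr
      exact (Submodule.Quotient.mk_eq_zero I).mp hr)
  · intro z
    obtain ⟨z, rfl⟩ := Submodule.Quotient.mk_surjective _ z
    constructor
    · intro h
      have h1 : z ∈ I ⊔ Ideal.span {c} := by
        exact (Submodule.Quotient.mk_eq_zero _).mp h
      obtain ⟨l, hl, w, hw, rfl⟩ := Submodule.mem_sup.mp h1
      obtain ⟨t, rfl⟩ := Ideal.mem_span_singleton.mp hw
      refine ⟨Submodule.Quotient.mk t, ?_⟩
      rw [Submodule.mapQ_apply]
      refine (Submodule.Quotient.eq _).mpr ?_
      simpa using hl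
    · rintro ⟨t, ht⟩
      obtain ⟨t, rfl⟩ := Submodule.Quotient.mk_surjective _ t
      rw [← ht, Submodule.mapQ_apply]
      refine (Submodule.Quotient.mk_eq_zero _).mpr ?_
      exact Ideal.mem_sup_right (Ideal.mem_span_singleton.mpr (dvd_mul_right _ _))

theorem ilen_inf_sup {R : Type*} [CommRing R] (I J : Ideal R) :
    ilen I + ilen J = ilen (I ⊓ J) + ilen (I ⊔ J) := by
  unfold ilen
  rw [← Module.length_prod]
  let f : R →ₗ[R] (R ⧸ I) × (R ⧸ J) := LinearMap.prod (Submodule.mkQ I) (Submodule.mkQ J)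
  have hker : LinearMap.ker f = I ⊓ J := by
    rw [LinearMap.ker_prod, Submodule.ker_mkQ, Submodule.ker_mkQ]
  let g : (R ⧸ I) × (R ⧸ J) →ₗ[R] (R ⧸ (I ⊔ J)) :=
    LinearMap.coprod (Submodule.factor le_sup_left) (-(Submodule.factor le_sup_right))
  refine Module.length_eq_add_of_exact (R := R) (Submodule.liftQ (I ⊓ J) f hker.ge) g ?_ ?_ ?_
  · rw [← LinearMap.ker_eq_bot]
    exact Submodule.ker_liftQ_eq_bot _ _ _ hker.le
  · intro z
    obtain ⟨z, rfl⟩ := Submodule.Quotient.mk_surjective _ z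
    refine ⟨(Submodule.Quotient.mk z, 0), ?_⟩
    simp [g]
  · rintro ⟨y, z⟩
    obtain ⟨y, rfl⟩ := Submodule.Quotient.mk_surjective _ y
    obtain ⟨z, rfl⟩ := Submodule.Quotient.mk_surjective _ z
    have hg : g (Submodule.Quotient.mk y, Submodule.Quotient.mk z)
        = Submodule.Quotient.mk (y - z) := by
      simp [g, sub_eq_add_neg]
    rw [hg]
    constructor
    · intro h
      obtain ⟨l, hl, w, hw, he⟩ := Submodule.mem_sup.mp ((Submodule.Quotient.mk_eq_zero _).mp h)
      refine ⟨Submodule.Quotient.mk (y - l), ?_⟩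
      rw [Submodule.liftQ_apply]
      refine Prod.ext ((Submodule.Quotient.eq _).mpr ?_) ((Submodule.Quotient.eq _).mpr ?_)
      · simpa using hl
      · have : y - l - z = w := by linear_combination -he
        rw [this]; exact hw
    · rintro ⟨t, ht⟩
      obtain ⟨t, rfl⟩ := Submodule.Quotient.mk_surjective _ t
      rw [Submodule.liftQ_apply] at ht
      have h1 : t - y ∈ I := (Submodule.Quotient.eq _).mp (congrArg Prod.fst ht)
      have h2 : t - z ∈ J := (Submodule.Quotient.eq _).mp (congrArg Prod.snd ht)
      refine (Submodule.Quotient.mk_eq_zero _).mpr ?_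
      have : y - z = -(t - y) + (t - z) := by ring
      rw [this]
      exact Submodule.add_mem_sup (I.neg_mem h1) h2

theorem ilen_eq {R : Type*} [CommRing R] {I J : Ideal R} (h : I ≤ J) (hlen : ilen I ≤ ilen J)
    (hfin : ilen J ≠ ⊤) : I = J := by
  refine le_antisymm h fun c hc => ?_
  have h1 := ilen_split I c
  have h2 : ilen J ≤ ilen (I ⊔ Ideal.span {c}) :=
    ilen_anti (sup_le h ((Ideal.span_singleton_le_iff_mem _).mpr hc))
  have h3 : ilen (cln I c) = 0 := by
    have hIJ : ilen I = ilen J := le_antisymm hlen (ilen_anti h)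
    have h4 : ilen (I ⊔ Ideal.span {c}) = ilen J :=
      le_antisymm (hIJ ▸ ilen_anti le_sup_left) h2
    rw [h4, hIJ] at h1
    obtain ⟨n, hn⟩ := ENat.ne_top_iff_exists.mp hfin
    rw [← hn] at h1
    have : ilen (cln I c) ≠ ⊤ := by
      intro h; rw [h] at h1; simp at h1
    obtain ⟨k, hk⟩ := ENat.ne_top_iff_exists.mp this
    rw [← hk] at h1 ⊢
    have : n = k + n := by exact_mod_cast h1
    have : k = 0 := by omega
    simp [this]
  have h5 : Subsingleton (R ⧸ cln I c) := Module.length_eq_zero_iff.mp h3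
  have h6 : cln I c = ⊤ := Ideal.Quotient.subsingleton_iff.mp h5
  have h7 : (1 : R) ∈ cln I c := h6 ▸ Submodule.mem_top
  simpa [mem_cln] using h7

theorem ilen_pow {R : Type*} [CommRing R] {L : Ideal R} {x : R} (h : RegMod L x) (n : ℕ) :
    ilen (L ⊔ Ideal.span {x ^ n}) = n * ilen (L ⊔ Ideal.span {x}) := by
  induction n with
  | zero => simp [ilen_top]
  | succ n ih =>
    rw [ilen_split _ (x ^ n)]
    have h1 : L ⊔ Ideal.span {x ^ (n + 1)} ⊔ Ideal.span {x ^ n} = L ⊔ Ideal.span {x ^ n} := by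
      rw [sup_assoc]
      congr 1
      rw [sup_eq_right, Ideal.span_singleton_le_span_singleton]
      exact pow_dvd_pow _ (by omega)
    have h2 : cln (L ⊔ Ideal.span {x ^ (n + 1)}) (x ^ n) = L ⊔ Ideal.span {x} := by
      ext r
      rw [mem_cln]
      constructor
      · intro hr
        obtain ⟨l, hl, w, hw, he⟩ := Submodule.mem_sup.mp hr
        obtain ⟨t, rfl⟩ := Ideal.mem_span_singleton.mp hw
        have h3 : r - x * t ∈ L := by
          apply h.pow n
          have : x ^ n * (r - x * t) = l := by linear_combination -he
          rw [this]; exact hl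
        have : r = (r - x * t) + x * t := by ring
        rw [this]
        exact Submodule.add_mem_sup h3 (Ideal.mem_span_singleton.mpr (dvd_mul_right _ _))
      · intro hr
        obtain ⟨l, hl, w, hw, rfl⟩ := Submodule.mem_sup.mp hr
        obtain ⟨t, rfl⟩ := Ideal.mem_span_singleton.mp hw
        have : x ^ n * (l + x * t) = x ^ n * l + x ^ (n + 1) * t := by ring
        rw [this]
        exact Submodule.add_mem_sup (L.mul_mem_left _ hl)
          (Ideal.mem_span_singleton.mpr (dvd_mul_right _ _))
    rw [h1, h2, ih]
    push_cast
    ring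

theorem ilen_pows {R : Type*} [CommRing R] (N : ℕ) (T : Finset R) : ∀ (L : Ideal R),
    (∀ T' ⊆ T, ∀ x ∈ T, x ∉ T' → RegMod (L ⊔ Ideal.span (T' : Set R)) x) →
    ilen (L ⊔ Ideal.span ((fun x => x ^ N) '' (T : Set R))) =
      (N : ℕ∞) ^ T.card * ilen (L ⊔ Ideal.span (T : Set R)) := by
  classical
  induction T using Finset.induction_on with
  | empty => intro L _; simp
  | insert k T hk ih =>
    intro L hL
    rw [Finset.coe_insert, Set.image_insert_eq, Ideal.span_insert, ← sup_assoc, ih,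
      sup_right_comm, ilen_pow, Finset.card_insert_of_notMem hk, Ideal.span_insert]
    · rw [pow_succ, mul_assoc, sup_assoc, sup_comm (Ideal.span (T : Set R))]
    · exact hL T (Finset.subset_insert _ _) k (Finset.mem_insert_self _ _) hk
    · intro T' hT' x hx hxT'
      rw [sup_right_comm]
      refine RegMod.swap (hL T' (hT'.trans (Finset.subset_insert _ _)) k
        (Finset.mem_insert_self _ _) (fun h => hk (hT' h))) ?_ N
      have := hL (insert k T') (Finset.insert_subset_insert _ hT') x
        (Finset.mem_insert_of_mem hx) (by
          rw [Finset.mem_insert, not_or]; exact ⟨fun h => hk (h ▸ hx), hxT'⟩)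
      rwa [Finset.coe_insert, Ideal.span_insert, sup_comm (Ideal.span {k}), ← sup_assoc] at this

section frob

variable {R : Type*} [CommRing R] [IsNoetherianRing R] [IsLocalRing R]

theorem ilen_max : ilen (maximalIdeal R) = 1 := by
  unfold ilen
  have : IsSimpleModule R (R ⧸ maximalIdeal R) :=
    isSimpleModule_iff_isCoatom.mpr (Ideal.isMaximal_def.mp (maximalIdeal.isMaximal R))
  exact Module.length_eq_one R _

/-- parameter ideals -/
def Qn (s : Finset R) (N : ℕ) : Ideal R := Ideal.span ((fun x => x ^ N) '' (s : Set R))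

theorem Qn_one (s : Finset R) : Qn s 1 = Ideal.span (s : Set R) := by
  simp [Qn]

theorem ilen_Qn (s : Finset R) (hm : maximalIdeal R = Ideal.span (s : Set R))
    (hd : (s.card : WithBot ℕ∞) ≤ ringKrullDim R) (N : ℕ) :
    ilen (Qn s N) = (N : ℕ∞) ^ s.card := by
  have := ilen_pows N s (⊥ : Ideal R) (by
    intro T hT x hx hxT
    rw [bot_sup_eq]
    exact aux_regMod s hm hd T hT x hx hxT)
  rwa [bot_sup_eq, bot_sup_eq, ← hm, ilen_max, mul_one] at this

theorem map_Qn (p e : ℕ) [ExpChar R p] (s : Finset R) (N : ℕ) :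
    (Qn s N).map (iterateFrobenius R p e) = Qn s (p ^ e * N) := by
  unfold Qn
  rw [Ideal.map_span, Set.image_image]
  congr 1
  apply Set.image_congr
  intro x _
  simp only [iterateFrobenius_def]
  rw [← pow_mul, mul_comm]

theorem exists_socle (I J : Ideal R) (k : ℕ) (hk : maximalIdeal R ^ k ≤ I) (hJ : ¬ J ≤ I) :
    ∃ c ∈ J, c ∉ I ∧ maximalIdeal R ≤ cln I c := by
  classical
  have hex : ∃ k, maximalIdeal R ^ k * J ≤ I := ⟨k, le_trans Ideal.mul_le_left hk⟩
  obtain ⟨n, hn, hmin⟩ : ∃ n, maximalIdeal R ^ n * J ≤ I ∧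
      ∀ m < n, ¬ maximalIdeal R ^ m * J ≤ I :=
    ⟨Nat.find hex, Nat.find_spec hex, fun m hm => Nat.find_min hex hm⟩
  cases n with
  | zero => exact absurd (by simpa using hn) hJ
  | succ n =>
    have h1 := hmin n (Nat.lt_succ_self n)
    obtain ⟨c, hc, hcI⟩ := SetLike.not_le_iff_exists.mp h1
    refine ⟨c, (Ideal.mul_le_right : maximalIdeal R ^ n * J ≤ J) hc, hcI, fun r hr => ?_⟩
    rw [mem_cln]
    apply hn
    rw [pow_succ', mul_assoc, mul_comm c r]
    exact Ideal.mul_mem_mul hr hc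

theorem ilen_upper (p e : ℕ) [ExpChar R p] (s : Finset R)
    (hm : maximalIdeal R = Ideal.span (s : Set R))
    (hd : (s.card : WithBot ℕ∞) ≤ ringKrullDim R) (k : ℕ) (J : Ideal R) : ∀ (I : Ideal R),
    maximalIdeal R ^ k ≤ I → I ≤ J →
    ilen (I.map (iterateFrobenius R p e)) + ((p ^ e : ℕ) : ℕ∞) ^ s.card * ilen J ≤
      ilen (J.map (iterateFrobenius R p e)) + ((p ^ e : ℕ) : ℕ∞) ^ s.card * ilen I := by
  intro I
  induction I using WellFoundedGT.induction with
  | ind I ih =>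
    intro hk hIJ
    by_cases hJI : J ≤ I
    · rw [le_antisymm hIJ hJI]
    obtain ⟨c, hcJ, hcI, hc⟩ := exists_socle I J k hk hJI
    have hlt : I < I ⊔ Ideal.span {c} := by
      refine lt_of_le_of_ne le_sup_left fun h => hcI ?_
      rw [h]
      exact Ideal.mem_sup_right (Ideal.mem_span_singleton_self c)
    have h1 := ih (I ⊔ Ideal.span {c}) hlt (hk.trans le_sup_left)
      (sup_le hIJ ((Ideal.span_singleton_le_iff_mem _).mpr hcJ))
    have h2 : cln I c = maximalIdeal R := by
      refine ((maximalIdeal.isMaximal R).eq_of_le (fun h => hcI ?_) hc).symm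
      have : (1 : R) ∈ cln I c := h ▸ Submodule.mem_top
      simpa [mem_cln] using this
    have h3 := ilen_split I c
    rw [h2, ilen_max] at h3
    have h4 := ilen_split (I.map (iterateFrobenius R p e)) (iterateFrobenius R p e c)
    have h5 : (I ⊔ Ideal.span {c}).map (iterateFrobenius R p e) =
        I.map (iterateFrobenius R p e) ⊔ Ideal.span {iterateFrobenius R p e c} := by
      rw [Ideal.map_sup, Ideal.map_span, Set.image_singleton]
    have h6 : ilen (cln (I.map (iterateFrobenius R p e)) (iterateFrobenius R p e c)) ≤
        ((p ^ e : ℕ) : ℕ∞) ^ s.card := by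
      rw [← ilen_Qn s hm hd, ← mul_one (p ^ e), ← map_Qn p e s 1, Qn_one, ← hm]
      apply ilen_anti
      rw [Ideal.map_le_iff_le_comap]
      intro r hr
      rw [Ideal.mem_comap, mem_cln, ← map_mul]
      exact Ideal.mem_map_of_mem _ (hc hr)
    rw [h5] at h1
    rw [h4, h3]
    calc _ ≤ ((p ^ e : ℕ) : ℕ∞) ^ s.card + (ilen (I.map (iterateFrobenius R p e) ⊔ Ideal.span {iterateFrobenius R p e c}) + ((p ^ e : ℕ) : ℕ∞) ^ s.card * ilen J) := by
          rw [add_assoc]; gcongr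
      _ ≤ _ := by
          refine (add_le_add_right h1 _).trans (le_of_eq ?_)
          ring

theorem ilen_frob (p e : ℕ) [ExpChar R p] (s : Finset R)
    (hm : maximalIdeal R = Ideal.span (s : Set R))
    (hd : (s.card : WithBot ℕ∞) ≤ ringKrullDim R) (k : ℕ) (I : Ideal R)
    (hk : maximalIdeal R ^ k ≤ I) :
    ilen (I.map (iterateFrobenius R p e)) = ((p ^ e : ℕ) : ℕ∞) ^ s.card * ilen I ∧
      ilen I ≠ ⊤ := by
  have hQ : Qn s k ≤ I := by
    refine le_trans ?_ hk
    unfold Qn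
    rw [Ideal.span_le]
    rintro _ ⟨x, hx, rfl⟩
    exact Ideal.pow_mem_pow (hm ▸ Ideal.subset_span hx) k
  have hfin : ilen I ≠ ⊤ := by
    refine ne_top_of_le_ne_top ?_ (ilen_anti hQ)
    rw [ilen_Qn s hm hd]
    exact_mod_cast ENat.natCast_ne_top (k ^ s.card)
  refine ⟨le_antisymm ?_ ?_, hfin⟩
  · have := ilen_upper p e s hm hd k ⊤ I hk le_top
    simpa [ilen_top, Ideal.map_top] using this
  · obtain ⟨k', hk'⟩ : ∃ k', maximalIdeal R ^ k' ≤ Qn s k := by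
      apply Ideal.exists_pow_le_of_le_radical_of_fg
      · rw [hm, Ideal.span_le]
        intro x hx
        exact ⟨k, Ideal.subset_span ⟨x, hx, rfl⟩⟩
      · exact IsNoetherian.noetherian _
    have := ilen_upper p e s hm hd k' I (Qn s k) hk' hQ
    rw [map_Qn, ilen_Qn s hm hd, ilen_Qn s hm hd, Nat.cast_mul, mul_pow, add_comm] at this
    have h3 : ((p ^ e : ℕ) : ℕ∞) ^ s.card * (k : ℕ∞) ^ s.card ≠ ⊤ := by
      exact_mod_cast ENat.natCast_ne_top ((p ^ e) ^ s.card * k ^ s.card)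
    exact (ENat.add_le_add_iff_right h3).mp this

theorem frob_cln_prim (p e : ℕ) [ExpChar R p] (s : Finset R)
    (hm : maximalIdeal R = Ideal.span (s : Set R))
    (hd : (s.card : WithBot ℕ∞) ≤ ringKrullDim R) (k : ℕ) (I : Ideal R)
    (hk : maximalIdeal R ^ k ≤ I) (c : R) :
    cln (I.map (iterateFrobenius R p e)) (iterateFrobenius R p e c) =
      (cln I c).map (iterateFrobenius R p e) := by
  symm
  have hkc : maximalIdeal R ^ k ≤ cln I c := fun r hr => I.mul_mem_left c (hk hr)
  have h1 := ilen_frob p e s hm hd k I hk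
  have h2 := ilen_frob p e s hm hd k _ (hk.trans (le_sup_left : I ≤ I ⊔ Ideal.span {c}))
  have h3 := ilen_frob p e s hm hd k _ hkc
  have h4 := ilen_split I c
  have h5 := ilen_split (I.map (iterateFrobenius R p e)) (iterateFrobenius R p e c)
  have h6 : (I ⊔ Ideal.span {c}).map (iterateFrobenius R p e) =
        I.map (iterateFrobenius R p e) ⊔ Ideal.span {iterateFrobenius R p e c} := by
      rw [Ideal.map_sup, Ideal.map_span, Set.image_singleton]
  have hq : ((p ^ e : ℕ) : ℕ∞) ^ s.card ≠ ⊤ := by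
    exact_mod_cast ENat.natCast_ne_top ((p ^ e) ^ s.card)
  rw [← h6, h2.1, h1.1, h4, mul_add] at h5
  have hfin := WithTop.mul_ne_top hq h2.2
  have h7 := WithTop.add_right_cancel hfin h5
  have h8 : (cln I c).map (iterateFrobenius R p e) ≤
      cln (I.map (iterateFrobenius R p e)) (iterateFrobenius R p e c) := by
    rw [Ideal.map_le_iff_le_comap]
    intro r hr
    rw [Ideal.mem_comap, mem_cln, ← map_mul]
    exact Ideal.mem_map_of_mem _ hr
  refine ilen_eq h8 ?_ ?_
  · rw [h3.1, h7]
  · rw [← h7]; exact WithTop.mul_ne_top hq h3.2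

theorem frob_inf_prim (p e : ℕ) [ExpChar R p] (s : Finset R)
    (hm : maximalIdeal R = Ideal.span (s : Set R))
    (hd : (s.card : WithBot ℕ∞) ≤ ringKrullDim R) (k : ℕ) (I J : Ideal R)
    (hk : maximalIdeal R ^ k ≤ I) (hk' : maximalIdeal R ^ k ≤ J) :
    I.map (iterateFrobenius R p e) ⊓ J.map (iterateFrobenius R p e) =
      (I ⊓ J).map (iterateFrobenius R p e) := by
  symm
  have h1 := ilen_frob p e s hm hd k I hk
  have h1' := ilen_frob p e s hm hd k J hk'
  have h2 := ilen_frob p e s hm hd k _ (hk.trans (le_sup_left : I ≤ I ⊔ J))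
  have h3 := ilen_frob p e s hm hd k _ (le_inf hk hk')
  have h4 := ilen_inf_sup I J
  have h5 := ilen_inf_sup (I.map (iterateFrobenius R p e)) (J.map (iterateFrobenius R p e))
  have hq : ((p ^ e : ℕ) : ℕ∞) ^ s.card ≠ ⊤ := by
    exact_mod_cast ENat.natCast_ne_top ((p ^ e) ^ s.card)
  rw [← Ideal.map_sup, h2.1, h1.1, h1'.1, ← mul_add, h4, mul_add] at h5
  have hfin := WithTop.mul_ne_top hq h2.2
  have h7 := WithTop.add_right_cancel hfin h5
  refine ilen_eq (le_inf (Ideal.map_mono inf_le_left) (Ideal.map_mono inf_le_right)) ?_ ?_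
  · rw [h3.1, h7]
  · rw [← h7]; exact WithTop.mul_ne_top hq h3.2

theorem artin_quot (k : ℕ) : IsArtinianRing (R ⧸ maximalIdeal R ^ k) := by
  rcases Nat.eq_zero_or_pos k with rfl | hk
  · have : Subsingleton (R ⧸ maximalIdeal R ^ 0) :=
      Ideal.Quotient.subsingleton_iff.mpr (by simp)
    infer_instance
  · apply IsLocalRing.quotient_artinian_of_mem_minimalPrimes_of_isLocalRing
    refine ⟨⟨inferInstance, Ideal.pow_le_self (by omega)⟩, fun P hP _ => ?_⟩
    have := hP.1
    exact Ideal.IsPrime.le_of_pow_le hP.2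

theorem mem_of_forall_sup (J : Ideal R) (L : R) (h : ∀ n, L ∈ J ⊔ maximalIdeal R ^ n) : L ∈ J := by
  by_cases hJ : J = ⊤
  · rw [hJ]; trivial
  have hnt : Nontrivial (R ⧸ J) := Ideal.Quotient.nontrivial_iff.mpr hJ
  have hH : IsHausdorff (maximalIdeal R) (R ⧸ J) :=
    IsHausdorff.of_isLocalRing _ _ (maximalIdeal.isMaximal R).ne_top
  rw [← Ideal.Quotient.eq_zero_iff_mem]
  apply hH.haus
  intro n
  rw [SModEq.zero]
  obtain ⟨j, hj, w, hw, rfl⟩ := Submodule.mem_sup.mp (h n)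
  rw [map_add, Ideal.Quotient.eq_zero_iff_mem.mpr hj, zero_add]
  have : Ideal.Quotient.mk J w = w • (1 : R ⧸ J) := by
    rw [Algebra.smul_def, mul_one]; rfl
  rw [this]
  exact Submodule.smul_mem_smul hw trivial

/-- Chevalley's lemma -/
theorem chevalley [IsAdicComplete (maximalIdeal R) R] (S : Set (Ideal R)) (hne : S.Nonempty)
    (hdir : ∀ I ∈ S, ∀ J ∈ S, ∃ K ∈ S, K ≤ I ∧ K ≤ J) (k : ℕ) :
    ∃ I ∈ S, I ≤ sInf S ⊔ maximalIdeal R ^ k := by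
  have hstab : ∀ k : ℕ, ∃ I ∈ S, ∀ J ∈ S, I ≤ J ⊔ maximalIdeal R ^ k := by
    intro k
    have hart : IsArtinianRing (R ⧸ maximalIdeal R ^ k) := by
      exact artin_quot k
    obtain ⟨M, ⟨I, hI, rfl⟩, hmin⟩ := IsArtinian.set_has_minimal
      ((fun I : Ideal R => I.map (Ideal.Quotient.mk (maximalIdeal R ^ k))) '' S)
      (hne.image _)
    refine ⟨I, hI, fun J hJ => ?_⟩
    obtain ⟨K, hK, hKI, hKJ⟩ := hdir I hI J hJ
    have h1 := hmin _ ⟨K, hK, rfl⟩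
    have h2 : K.map (Ideal.Quotient.mk (maximalIdeal R ^ k)) =
        I.map (Ideal.Quotient.mk (maximalIdeal R ^ k)) :=
      (Ideal.map_mono hKI).eq_of_not_lt h1
    have h3 : I.map (Ideal.Quotient.mk (maximalIdeal R ^ k)) ≤
        J.map (Ideal.Quotient.mk (maximalIdeal R ^ k)) := h2 ▸ Ideal.map_mono hKJ
    rw [Ideal.map_le_iff_le_comap, Ideal.comap_map_of_surjective _ Ideal.Quotient.mk_surjective,
      ← RingHom.ker_eq_comap_bot, Ideal.mk_ker] at h3
    exact h3
  choose V hVS hV using hstab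
  refine ⟨V k, hVS k, fun x hx => ?_⟩
  -- build the compatible sequence
  have hstep : ∀ (j : ℕ) (y : R), y ∈ V j ⊔ maximalIdeal R ^ j →
      ∃ z ∈ V (j + 1) ⊔ maximalIdeal R ^ (j + 1), y - z ∈ maximalIdeal R ^ j := by
    intro j y hy
    have h1 : y ∈ V (j + 1) ⊔ maximalIdeal R ^ j :=
      (sup_le (hV j _ (hVS (j + 1))) le_sup_right) hy
    obtain ⟨v, hv, w, hw, rfl⟩ := Submodule.mem_sup.mp h1
    exact ⟨v, Ideal.mem_sup_left hv, by simpa using hw⟩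
  choose! nxt hnxt1 hnxt2 using hstep
  let f : ℕ → R := fun n => Nat.rec x (fun j y => nxt (k + j) y) n
  have hf0 : f 0 = x := rfl
  have hfs : ∀ n, f (n + 1) = nxt (k + n) (f n) := fun n => rfl
  have hfm : ∀ n, f n ∈ V (k + n) ⊔ maximalIdeal R ^ (k + n) := by
    intro n
    induction n with
    | zero => exact Ideal.mem_sup_left hx
    | succ n ih => rw [hfs]; exact hnxt1 _ _ ih
  have hfd : ∀ n, f n - f (n + 1) ∈ maximalIdeal R ^ (k + n) := fun n => by
    rw [hfs]; exact hnxt2 _ _ (hfm n)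
  have hfd' : ∀ m n, m ≤ n → f m - f n ∈ maximalIdeal R ^ (k + m) := by
    intro m n hmn
    induction n, hmn using Nat.le_induction with
    | base => simp
    | succ n hmn ih =>
      have : f m - f (n + 1) = (f m - f n) + (f n - f (n + 1)) := by ring
      rw [this]
      exact Ideal.add_mem _ ih (Ideal.pow_le_pow_right (by omega) (hfd n))
  obtain ⟨L, hL⟩ := IsPrecomplete.prec (I := maximalIdeal R) (M := R) inferInstance (f := f) (by
    intro m n hmn
    rw [SModEq.sub_mem, smul_eq_mul, Ideal.mul_top]
    exact Ideal.pow_le_pow_right (by omega) (hfd' m n hmn))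
  have hL' : ∀ n, f n - L ∈ maximalIdeal R ^ n := by
    intro n
    have := hL n
    rwa [SModEq.sub_mem, smul_eq_mul, Ideal.mul_top] at this
  have hLS : L ∈ sInf S := by
    rw [Submodule.mem_sInf]
    intro J hJ
    have h1 : ∀ n, L ∈ J ⊔ maximalIdeal R ^ n := by
      intro n
      have h2 : L = f n - (f n - L) := by ring
      rw [h2]
      refine Ideal.sub_mem _ ?_ (Ideal.mem_sup_right (hL' n))
      have h3 : V (k + n) ⊔ maximalIdeal R ^ (k + n) ≤ J ⊔ maximalIdeal R ^ n :=
        sup_le ((hV (k + n) J hJ).trans (sup_le_sup_left (Ideal.pow_le_pow_right (by omega)) _))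
          ((Ideal.pow_le_pow_right (by omega)).trans le_sup_right)
      exact h3 (hfm n)
    exact mem_of_forall_sup J L h1
  have hxL : x - L ∈ maximalIdeal R ^ k := by
    have h1 : x - L = (f 0 - f k) + (f k - L) := by rw [hf0]; ring
    rw [h1]
    exact Ideal.add_mem _ (by simpa using hfd' 0 k (by omega)) (hL' k)
  have : x = L + (x - L) := by ring
  rw [this]
  exact Submodule.add_mem_sup hLS hxL

end frob

theorem stab_art {A : Type*} [CommRing A] [IsNoetherianRing A] [IsLocalRing A] (J : ℕ → Ideal A)
    (hanti : Antitone J) (k : ℕ) (h : ∀ n, maximalIdeal A ^ k * J 0 ≤ J n) :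
    ∃ n, J n = J (n + 1) := by
  have hart : IsArtinianRing (A ⧸ maximalIdeal A ^ k) := artin_quot k
  let N : Submodule A (J 0) := (maximalIdeal A ^ k) • (⊤ : Submodule A (J 0))
  have hfin : Module.Finite (A ⧸ maximalIdeal A ^ k) (J 0 ⧸ N) :=
    Module.Finite.of_restrictScalars_finite A _ _
  have h1 : IsArtinian (A ⧸ maximalIdeal A ^ k) (J 0 ⧸ N) := inferInstance
  have h2 : IsArtinian A (J 0 ⧸ N) :=
    isArtinian_of_surjective_algebraMap (S := A) (R := A ⧸ maximalIdeal A ^ k)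
      Ideal.Quotient.mk_surjective
  let f : ℕ →o (Submodule A (J 0 ⧸ N))ᵒᵈ :=
    ⟨fun n => OrderDual.toDual (Submodule.map N.mkQ (Submodule.comap (J 0).subtype (J n))), by
      intro a b hab
      exact Submodule.map_mono (Submodule.comap_mono (hanti hab))⟩
  obtain ⟨n, hn⟩ := IsArtinian.monotone_stabilizes f
  refine ⟨n, le_antisymm ?_ (hanti (Nat.le_succ n))⟩
  have h3 : Submodule.map N.mkQ (Submodule.comap (J 0).subtype (J n)) =
      Submodule.map N.mkQ (Submodule.comap (J 0).subtype (J (n + 1))) := hn (n + 1) (Nat.le_succ n)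
  have hN : N ≤ Submodule.comap (J 0).subtype (J (n + 1)) := by
    rw [Submodule.smul_le]
    intro r hr x _
    exact h (n + 1) (Ideal.mul_mem_mul hr x.2)
  intro x hx
  have hx0 : x ∈ J 0 := hanti (Nat.zero_le n) hx
  have h4 : N.mkQ ⟨x, hx0⟩ ∈ Submodule.map N.mkQ (Submodule.comap (J 0).subtype (J (n + 1))) := by
    rw [← h3]
    exact ⟨⟨x, hx0⟩, hx, rfl⟩
  obtain ⟨y, hy, hyx⟩ := h4
  have h5 : y - ⟨x, hx0⟩ ∈ N := (Submodule.Quotient.eq _).mp hyx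
  have h6 := hN h5
  have h7 : (y : A) - x ∈ J (n + 1) := h6
  have h8 : (y : A) ∈ J (n + 1) := hy
  have : x = y - (y - x) := by ring
  rw [this]
  exact Ideal.sub_mem _ h8 h7

theorem hsl {R : Type*} [CommRing R] [IsNoetherianRing R] (ψ : Ideal R → Ideal R)
    (hmono : Monotone ψ) (q : ℕ) (hq : 2 ≤ q)
    (hψ : ∀ (c : R) (J : Ideal R), ∀ x ∈ ψ J, c * x ∈ ψ (Ideal.span {c ^ q} * J)) :
    ∃ n₀, ∀ n ≥ n₀, ψ^[n] ⊤ = ψ^[n₀] ⊤ := by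
  classical
  set J : ℕ → Ideal R := fun n => ψ^[n] ⊤ with hJ
  have hJs : ∀ n, J (n + 1) = ψ (J n) := fun n => Function.iterate_succ_apply' ψ n ⊤
  have hstep : ∀ n, J (n + 1) ≤ J n := by
    intro n
    induction n with
    | zero => exact le_top
    | succ n ih => rw [hJs (n + 1)]; exact (hmono ih).trans (hJs n).ge
  have hanti : Antitone J := antitone_nat_of_succ_le hstep
  let a : ℕ → Ideal R := fun n => ⨅ x ∈ J n, cln (J (n + 1)) x
  have hmem : ∀ n c, c ∈ a n ↔ ∀ x ∈ J n, c * x ∈ J (n + 1) := by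
    intro n c
    simp only [a, Submodule.mem_iInf, mem_cln, mul_comm c]
  have hamono : ∀ n, a n ≤ a (n + 1) := by
    intro n c hc
    rw [hmem] at hc ⊢
    intro x hx
    rw [hJs n] at hx
    rw [hJs (n + 1)]
    refine hmono ?_ (hψ c _ x hx)
    rw [Ideal.span_singleton_mul_le_iff]
    intro z hz
    obtain ⟨r, rfl⟩ : ∃ r, q = r + 1 := ⟨q - 1, by omega⟩
    rw [pow_succ, mul_assoc]
    exact Ideal.mul_mem_left _ _ (hc z hz)
  obtain ⟨n₀, hn₀⟩ := monotone_stabilizes_iff_noetherian.mpr (inferInstance : IsNoetherian R R)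
    ⟨a, monotone_nat_of_le_succ hamono⟩
  have ha : ∀ m, n₀ ≤ m → a n₀ = a m := hn₀
  by_cases htop : a n₀ = ⊤
  · refine ⟨n₀, fun n hn => ?_⟩
    induction n, hn using Nat.le_induction with
    | base => rfl
    | succ n hn ih =>
      change J (n + 1) = J n₀
      change J n = J n₀ at ih
      rw [← ih]
      refine le_antisymm (hstep n) fun x hx => ?_
      have h1 : (1 : R) ∈ a n := by rw [← ha n hn, htop]; trivial
      simpa using (hmem n 1).mp h1 x hx
  exfalso
  obtain ⟨P, hP⟩ := Ideal.nonempty_minimalPrimes htop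
  have hPp : P.IsPrime := hP.1.1
  have hsq : ∀ n, n₀ ≤ n → a n₀ ^ 2 * J n₀ ≤ J n := by
    intro n hn
    induction n, hn using Nat.le_induction with
    | base => exact Ideal.mul_le_right
    | succ n hn ih =>
      rw [sq, mul_assoc, Ideal.mul_le]
      intro c hc z hz
      have hz' : z ∈ J (n₀ + 1) := by
        have : a n₀ * J n₀ ≤ J (n₀ + 1) := by
          rw [Ideal.mul_le]
          intro r hr s hs
          exact (hmem n₀ r).mp hr s hs
        exact this hz
      rw [hJs n₀] at hz'
      rw [hJs n]
      refine hmono ?_ (hψ c _ z hz')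
      refine le_trans (Ideal.mul_mono_left ?_) ih
      rw [Ideal.span_singleton_le_iff_mem]
      exact Ideal.pow_le_pow_right hq (Ideal.pow_mem_pow hc q)
  let A := Localization.AtPrime P
  have hAn : IsNoetherianRing A := IsLocalization.isNoetherianRing P.primeCompl A inferInstance
  have hrad : maximalIdeal A ≤ ((a n₀).map (algebraMap R A)).radical := by
    rw [Ideal.radical_eq_sInf]
    refine le_sInf fun Q hQ => ?_
    obtain ⟨hQ1, hQ2⟩ := hQ
    have hle : Q.comap (algebraMap R A) ≤ P := by
      have h1 : Q ≤ maximalIdeal A := IsLocalRing.le_maximalIdeal hQ2.ne_top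
      refine (Ideal.comap_mono h1).trans ?_
      exact (Localization.AtPrime.under_maximalIdeal (I := P)).le
    have h2 : P ≤ Q.comap (algebraMap R A) :=
      hP.2 ⟨hQ2.comap _, Ideal.map_le_iff_le_comap.mp hQ1⟩ hle
    rw [← Localization.AtPrime.map_eq_maximalIdeal, Ideal.map_le_iff_le_comap]
    exact h2
  obtain ⟨k, hk⟩ := Ideal.exists_pow_le_of_le_radical_of_fg hrad (IsNoetherian.noetherian _)
  obtain ⟨n, hn⟩ := stab_art (fun n => (J (n₀ + n)).map (algebraMap R A))
    (fun i j hij => Ideal.map_mono (hanti (by omega))) (k * 2) (by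
      intro n
      have h1 := Ideal.map_mono (f := algebraMap R A) (hsq (n₀ + n) (by omega))
      rw [Ideal.map_mul, Ideal.map_pow] at h1
      refine le_trans (Ideal.mul_mono_left ?_) h1
      rw [pow_mul]
      exact Ideal.pow_right_mono hk 2)
  have hloc : ∀ x ∈ J (n₀ + n), ∃ s ∈ P.primeCompl, s * x ∈ J (n₀ + n + 1) := by
    intro x hx
    have h1 : algebraMap R A x ∈ (J (n₀ + n + 1)).map (algebraMap R A) := by
      have : (J (n₀ + n)).map (algebraMap R A) = (J (n₀ + n + 1)).map (algebraMap R A) := hn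
      rw [← this]
      exact Ideal.mem_map_of_mem _ hx
    rw [IsLocalization.algebraMap_mem_map_algebraMap_iff P.primeCompl] at h1
    exact h1
  obtain ⟨t, ht⟩ := (IsNoetherian.noetherian (J (n₀ + n)) : (J (n₀ + n)).FG)
  have ht' : ∀ x ∈ t, x ∈ J (n₀ + n) := fun x hx => ht ▸ Submodule.subset_span hx
  choose! f hf1 hf2 using hloc
  have hprod : (∏ x ∈ t, f x) ∈ a (n₀ + n) := by
    rw [hmem]
    intro x hx
    have h1 : J (n₀ + n) ≤ cln (J (n₀ + n + 1)) (∏ x ∈ t, f x) := by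
      rw [← ht, Submodule.span_le]
      intro z hz
      change (∏ x ∈ t, f x) * z ∈ J (n₀ + n + 1)
      rw [← Finset.mul_prod_erase t f hz, mul_comm (f z), mul_assoc]
      exact Ideal.mul_mem_left _ _ (hf2 z (ht' z hz))
    exact h1 hx
  rw [← ha (n₀ + n) (by omega)] at hprod
  have h1 := hP.1.2 hprod
  have h2 : (∏ x ∈ t, f x) ∈ P.primeCompl := Submonoid.prod_mem _ fun x hx => hf1 x (ht' x hx)
  exact h2 h1

section partE

variable {R : Type*} [CommRing R]

theorem bracket_eq (p e : ℕ) [ExpChar R p] (I : Ideal R) :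
    bracketPow I (p ^ e) = I.map (iterateFrobenius R p e) := by
  unfold bracketPow Ideal.map
  congr 1

variable [IsNoetherianRing R] [IsLocalRing R]

theorem map_frob_le (p e : ℕ) [ExpChar R p] (I : Ideal R) :
    I.map (iterateFrobenius R p e) ≤ I := by
  rw [Ideal.map_le_iff_le_comap]
  intro x hx
  rw [Ideal.mem_comap, iterateFrobenius_def]
  exact Ideal.pow_mem_of_mem _ hx _ (pow_pos (expChar_pos R p) e)

theorem frob_dir [IsAdicComplete (maximalIdeal R) R] (p e : ℕ) [ExpChar R p] (S : Set (Ideal R))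
    (hne : S.Nonempty)
    (hdir : ∀ I ∈ S, ∀ J ∈ S, ∃ K ∈ S, K ≤ I ∧ K ≤ J) (x : R)
    (hx : ∀ I ∈ S, x ∈ I.map (iterateFrobenius R p e)) :
    x ∈ (sInf S).map (iterateFrobenius R p e) := by
  apply mem_of_forall_sup
  intro n
  obtain ⟨I, hI, hle⟩ := chevalley S hne hdir n
  have h1 := Ideal.map_mono (f := iterateFrobenius R p e) hle (hx I hI)
  rw [Ideal.map_sup] at h1
  have h2 : (sInf S).map (iterateFrobenius R p e) ⊔
      (maximalIdeal R ^ n).map (iterateFrobenius R p e) ≤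
      (sInf S).map (iterateFrobenius R p e) ⊔ maximalIdeal R ^ n :=
    sup_le_sup_left (map_frob_le p e _) _
  exact h2 h1

theorem frob_cln [IsAdicComplete (maximalIdeal R) R] (p e : ℕ) [ExpChar R p] (s : Finset R)
    (hm : maximalIdeal R = Ideal.span (s : Set R))
    (hd : (s.card : WithBot ℕ∞) ≤ ringKrullDim R) (I : Ideal R) (c : R) :
    cln (I.map (iterateFrobenius R p e)) (iterateFrobenius R p e c) ≤
      (cln I c).map (iterateFrobenius R p e) := by
  intro x hx
  have hS : sInf (Set.range fun k => cln (I ⊔ maximalIdeal R ^ k) c) ≤ cln I c := by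
    intro r hr
    rw [mem_cln]
    apply mem_of_forall_sup
    intro n
    rw [← mem_cln]
    exact (Submodule.mem_sInf.mp hr) _ ⟨n, rfl⟩
  refine Ideal.map_mono hS (frob_dir p e _ (Set.range_nonempty _) ?_ x ?_)
  · rintro _ ⟨i, rfl⟩ _ ⟨j, rfl⟩
    refine ⟨_, ⟨max i j, rfl⟩, ?_, ?_⟩
    · exact Submodule.comap_mono (sup_le_sup_left (Ideal.pow_le_pow_right (le_max_left _ _)) _)
    · exact Submodule.comap_mono (sup_le_sup_left (Ideal.pow_le_pow_right (le_max_right _ _)) _)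
  · rintro _ ⟨k, rfl⟩
    rw [← frob_cln_prim p e s hm hd k _ le_sup_right]
    rw [mem_cln] at hx ⊢
    exact Ideal.map_mono le_sup_left hx

theorem frob_inf [IsAdicComplete (maximalIdeal R) R] (p e : ℕ) [ExpChar R p] (s : Finset R)
    (hm : maximalIdeal R = Ideal.span (s : Set R))
    (hd : (s.card : WithBot ℕ∞) ≤ ringKrullDim R) (I J : Ideal R) :
    I.map (iterateFrobenius R p e) ⊓ J.map (iterateFrobenius R p e) ≤
      (I ⊓ J).map (iterateFrobenius R p e) := by
  intro x hx
  have hS : sInf (Set.range fun k => (I ⊔ maximalIdeal R ^ k) ⊓ (J ⊔ maximalIdeal R ^ k)) ≤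
      I ⊓ J := by
    intro r hr
    have h1 := fun n => (Submodule.mem_sInf.mp hr) _ ⟨n, rfl⟩
    exact ⟨mem_of_forall_sup _ _ fun n => (h1 n).1, mem_of_forall_sup _ _ fun n => (h1 n).2⟩
  refine Ideal.map_mono hS (frob_dir p e _ (Set.range_nonempty _) ?_ x ?_)
  · rintro _ ⟨i, rfl⟩ _ ⟨j, rfl⟩
    refine ⟨_, ⟨max i j, rfl⟩, ?_, ?_⟩
    · exact inf_le_inf (sup_le_sup_left (Ideal.pow_le_pow_right (le_max_left _ _)) _)
        (sup_le_sup_left (Ideal.pow_le_pow_right (le_max_left _ _)) _)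
    · exact inf_le_inf (sup_le_sup_left (Ideal.pow_le_pow_right (le_max_right _ _)) _)
        (sup_le_sup_left (Ideal.pow_le_pow_right (le_max_right _ _)) _)
  · rintro _ ⟨k, rfl⟩
    rw [← frob_inf_prim p e s hm hd k _ _ le_sup_right le_sup_right]
    exact ⟨Ideal.map_mono le_sup_left hx.1, Ideal.map_mono le_sup_left hx.2⟩

theorem star_all [IsAdicComplete (maximalIdeal R) R] (p : ℕ) [ExpChar R p] (s : Finset R)
    (hm : maximalIdeal R = Ideal.span (s : Set R))
    (hd : (s.card : WithBot ℕ∞) ≤ ringKrullDim R) (a : Ideal R) (e : ℕ) :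
    a ≤ (Ie p a e).map (iterateFrobenius R p e) := by
  intro x hx
  refine frob_dir p e _ ⟨⊤, ?_⟩ ?_ x ?_
  · change a ≤ bracketPow ⊤ (p ^ e)
    rw [bracket_eq, Ideal.map_top]
    exact le_top
  · intro I hI J hJ
    refine ⟨I ⊓ J, ?_, inf_le_left, inf_le_right⟩
    change a ≤ bracketPow _ (p ^ e)
    change a ≤ bracketPow _ (p ^ e) at hI
    change a ≤ bracketPow _ (p ^ e) at hJ
    rw [bracket_eq] at hI hJ ⊢
    exact (le_inf hI hJ).trans (frob_inf p e s hm hd I J)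
  · intro I hI
    rw [← bracket_eq]
    exact hI hx

end partE

section partE2

variable {R : Type*} [CommRing R] (p : ℕ) [ExpChar R p]

theorem Ie_le (a I : Ideal R) (e : ℕ) (h : a ≤ I.map (iterateFrobenius R p e)) : Ie p a e ≤ I := by
  apply sInf_le
  change a ≤ bracketPow _ _
  rwa [bracket_eq]

theorem Ie_mono {R : Type*} [CommRing R] (p : ℕ) {a b : Ideal R} (h : a ≤ b) (e : ℕ) :
    Ie p a e ≤ Ie p b e :=
  sInf_le_sInf fun _ hI => h.trans hI

theorem Ie_comp (hS : ∀ (a : Ideal R) (e : ℕ), a ≤ (Ie p a e).map (iterateFrobenius R p e))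
    (a : Ideal R) (e e' : ℕ) : Ie p (Ie p a e) e' = Ie p a (e + e') := by
  apply le_antisymm
  · apply Ie_le
    apply Ie_le
    rw [Ideal.map_map, ← iterateFrobenius_add]
    exact hS a _
  · apply Ie_le
    rw [iterateFrobenius_add, ← Ideal.map_map]
    exact (hS a e).trans (Ideal.map_mono (hS _ e'))

theorem Ie_mul (hS : ∀ (a : Ideal R) (e : ℕ), a ≤ (Ie p a e).map (iterateFrobenius R p e))
    (hC : ∀ (e : ℕ) (I : Ideal R) (c : R),
      cln (I.map (iterateFrobenius R p e)) (iterateFrobenius R p e c) ≤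
      (cln I c).map (iterateFrobenius R p e))
    (a : Ideal R) (c : R) (e : ℕ) :
    Ie p (Ideal.span {c ^ p ^ e} * a) e = Ideal.span {c} * Ie p a e := by
  apply le_antisymm
  · apply Ie_le
    rw [Ideal.map_mul, Ideal.map_span, Set.image_singleton, iterateFrobenius_def]
    exact Ideal.mul_mono_right (hS a e)
  · rw [Ideal.span_singleton_mul_le_iff]
    intro z hz
    rw [← mem_cln]
    refine Ie_le p _ _ e ?_ hz
    refine le_trans ?_ (hC e _ c)
    intro x hx
    rw [mem_cln, iterateFrobenius_def]
    exact hS _ e (Ideal.mul_mem_mul (Ideal.mem_span_singleton_self _) hx)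

theorem Ie_top (hS : ∀ (a : Ideal R) (e : ℕ), a ≤ (Ie p a e).map (iterateFrobenius R p e))
    (e : ℕ) : Ie p (⊤ : Ideal R) e = ⊤ := by
  have h := hS ⊤ e
  rw [top_le_iff, Ideal.eq_top_iff_one] at h
  rw [Ideal.eq_top_iff_one]
  have h2 : (Ie p (⊤ : Ideal R) e).map (iterateFrobenius R p e) ≤ Ie p (⊤ : Ideal R) e := by
    rw [Ideal.map_le_iff_le_comap]
    intro x hx
    rw [Ideal.mem_comap, iterateFrobenius_def]
    exact Ideal.pow_mem_of_mem _ hx _ (pow_pos (expChar_pos R p) e)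
  exact h2 h

/-- the exponents of the approximating sequence -/
def seqS (a q : ℕ) : ℕ → ℕ
  | 0 => 0
  | n + 1 => seqS a q n + a * q ^ n

theorem Ie_iter (hS : ∀ (a : Ideal R) (e : ℕ), a ≤ (Ie p a e).map (iterateFrobenius R p e))
    (hC : ∀ (e : ℕ) (I : Ideal R) (c : R),
      cln (I.map (iterateFrobenius R p e)) (iterateFrobenius R p e c) ≤
      (cln I c).map (iterateFrobenius R p e))
    (g : R) (a β n : ℕ) :
    (fun J => Ie p (Ideal.span {g ^ a} * J) β)^[n] ⊤ =
      Ie p (Ideal.span {g ^ seqS a (p ^ β) n}) (n * β) := by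
  induction n with
  | zero => simp [seqS, Ie_top p hS]
  | succ n ih =>
    rw [Function.iterate_succ_apply', ih, ← Ie_mul p hS hC, Ie_comp p hS, seqS,
      Ideal.span_singleton_mul_span_singleton, Nat.succ_mul]
    congr 3
    rw [pow_add, mul_comm, ← pow_mul, ← pow_mul, mul_comm β n]

theorem K_stab [IsNoetherianRing R] (hp : p.Prime)
    (hS : ∀ (a : Ideal R) (e : ℕ), a ≤ (Ie p a e).map (iterateFrobenius R p e))
    (hC : ∀ (e : ℕ) (I : Ideal R) (c : R),
      cln (I.map (iterateFrobenius R p e)) (iterateFrobenius R p e c) ≤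
      (cln I c).map (iterateFrobenius R p e))
    (g : R) (a d β : ℕ) (hβ : 1 ≤ β) :
    ∃ n₀, ∀ n ≥ n₀, Ie p (Ideal.span {g ^ seqS a (p ^ β) n}) (n * β + d) =
      Ie p (Ideal.span {g ^ seqS a (p ^ β) n₀}) (n₀ * β + d) := by
  obtain ⟨n₀, h⟩ := hsl (fun J => Ie p (Ideal.span {g ^ a} * J) β)
    (fun I J h => Ie_mono p (Ideal.mul_mono_right h) β) (p ^ β)
    (hp.two_le.trans (Nat.le_self_pow (by omega) p)) (by
      intro c J x hx
      have : Ideal.span {g ^ a} * (Ideal.span {c ^ p ^ β} * J) =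
        Ideal.span {c ^ p ^ β} * (Ideal.span {g ^ a} * J) := mul_left_comm _ _ _
      rw [this, Ie_mul p hS hC]
      exact Ideal.mul_mem_mul (Ideal.mem_span_singleton_self _) hx)
  refine ⟨n₀, fun n hn => ?_⟩
  have h1 := h n hn
  rw [Ie_iter p hS hC, Ie_iter p hS hC] at h1
  rw [← Ie_comp p hS, h1, Ie_comp p hS]

theorem Ie_scale (hS : ∀ (a : Ideal R) (e : ℕ), a ≤ (Ie p a e).map (iterateFrobenius R p e))
    (hC : ∀ (e : ℕ) (I : Ideal R) (c : R),
      cln (I.map (iterateFrobenius R p e)) (iterateFrobenius R p e c) ≤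
      (cln I c).map (iterateFrobenius R p e))
    (g : R) (m e k : ℕ) :
    Ie p (Ideal.span {g ^ (m * p ^ k)}) (k + e) = Ie p (Ideal.span {g ^ m}) e := by
  rw [← Ie_comp p hS]
  have := Ie_mul p hS hC ⊤ (g ^ m) k
  rw [Ideal.mul_top, Ie_top p hS, Ideal.mul_top, ← pow_mul] at this
  rw [this]

theorem tau_anti {R : Type*} [CommRing R] (p : ℕ) (b : Ideal R) : Antitone (tau p b) := by
  intro c c' h
  refine iSup_mono fun e => Ie_mono p (Ideal.pow_le_pow_right ?_) _
  exact Nat.ceil_mono (mul_le_mul_of_nonneg_right h (by positivity))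

theorem tau_eq (hp : p.Prime)
    (hS : ∀ (a : Ideal R) (e : ℕ), a ≤ (Ie p a e).map (iterateFrobenius R p e))
    (hC : ∀ (e : ℕ) (I : Ideal R) (c : R),
      cln (I.map (iterateFrobenius R p e)) (iterateFrobenius R p e c) ≤
      (cln I c).map (iterateFrobenius R p e))
    (g : R) (s e : ℕ) (he : 1 ≤ e) :
    tau p (Ideal.span {g}) ((s : ℝ) / (p : ℝ) ^ e) = Ie p (Ideal.span {g ^ s}) e := by
  have hp0 : (0 : ℝ) < (p : ℝ) ^ e := by have := hp.pos; positivity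
  apply le_antisymm
  · refine iSup_le fun ⟨e', he'⟩ => ?_
    dsimp only
    rw [Ideal.span_singleton_pow]
    set m := ⌈(s : ℝ) / (p : ℝ) ^ e * (p : ℝ) ^ e'⌉₊ with hm
    have h1 : s * p ^ e' ≤ m * p ^ e := by
      have h2 := Nat.le_ceil ((s : ℝ) / (p : ℝ) ^ e * (p : ℝ) ^ e')
      rw [← hm, div_mul_eq_mul_div, div_le_iff₀ hp0] at h2
      exact_mod_cast h2
    rw [← Ie_scale p hS hC g m e' e, ← Ie_scale p hS hC g s e e', add_comm e e']
    refine Ie_mono p ?_ _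
    rw [Ideal.span_singleton_le_span_singleton]
    exact pow_dvd_pow g h1
  · refine le_trans (le_of_eq ?_) (le_iSup _ ⟨e, he⟩)
    dsimp only
    rw [div_mul_cancel₀ _ hp0.ne', Nat.ceil_natCast, Ideal.span_singleton_pow]

end partE2

section partF

theorem seqS_eq (a q n : ℕ) : (seqS a q n : ℝ) * ((q : ℝ) - 1) = a * ((q : ℝ) ^ n - 1) := by
  induction n with
  | zero => simp [seqS]
  | succ n ih =>
    rw [seqS]
    push_cast
    rw [add_mul, ih]
    ring

theorem right_const {R : Type*} [CommRing R] [IsNoetherianRing R] (f : ℝ → Ideal R)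
    (hf : Antitone f) (x : ℝ) :
    ∃ δ > 0, ∀ c c', x < c → c < x + δ → x < c' → c' < x + δ → f c = f c' := by
  obtain ⟨n, hn⟩ := monotone_stabilizes_iff_noetherian.mpr (inferInstance : IsNoetherian R R)
    ⟨fun n : ℕ => f (x + 1 / ((n : ℝ) + 1)), fun i j hij => hf (by
      have := one_div_le_one_div_of_le (by positivity : (0 : ℝ) < (i : ℝ) + 1)
        (by exact_mod_cast Nat.succ_le_succ hij : (i : ℝ) + 1 ≤ (j : ℝ) + 1)
      linarith)⟩
  have hn' : ∀ m : ℕ, n ≤ m → f (x + 1 / ((n : ℝ) + 1)) = f (x + 1 / ((m : ℝ) + 1)) := hn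
  have key : ∀ c, x < c → c < x + 1 / ((n : ℝ) + 1) → f c = f (x + 1 / ((n : ℝ) + 1)) := by
    intro c h1 h2
    obtain ⟨m, hm⟩ := exists_nat_one_div_lt (sub_pos.mpr h1)
    apply le_antisymm
    · rw [hn' (max n m) (le_max_left _ _)]
      apply hf
      have := one_div_le_one_div_of_le (by positivity : (0 : ℝ) < (m : ℝ) + 1)
        (by exact_mod_cast Nat.succ_le_succ (le_max_right n m) :
          (m : ℝ) + 1 ≤ ((max n m : ℕ) : ℝ) + 1)
      linarith
    · exact hf h2.le
  exact ⟨1 / ((n : ℝ) + 1), by positivity, fun c c' h1 h2 h3 h4 => by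
    rw [key c h1 h2, key c' h3 h4]⟩

theorem left_const {R : Type*} [CommRing R] [IsNoetherianRing R] (p : ℕ) [ExpChar R p]
    (hp : p.Prime)
    (hS : ∀ (a : Ideal R) (e : ℕ), a ≤ (Ie p a e).map (iterateFrobenius R p e))
    (hC : ∀ (e : ℕ) (I : Ideal R) (c : R),
      cln (I.map (iterateFrobenius R p e)) (iterateFrobenius R p e c) ≤
      (cln I c).map (iterateFrobenius R p e))
    (g : R) (a d β : ℕ) (hβ : 1 ≤ β) (ha : 1 ≤ a) (x : ℝ)
    (hx : x = (a : ℝ) / ((p : ℝ) ^ d * ((p : ℝ) ^ β - 1))) :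
    ∃ δ > 0, ∀ c c', x - δ < c → c < x → x - δ < c' → c' < x →
      tau p (Ideal.span {g}) c = tau p (Ideal.span {g}) c' := by
  obtain ⟨n₀, h⟩ := K_stab p hp hS hC g a d β hβ
  have hq1 : (1 : ℝ) < (p : ℝ) ^ β :=
    one_lt_pow₀ (by exact_mod_cast hp.one_lt) (by omega)
  have hpd : (0 : ℝ) < (p : ℝ) ^ d := by have := hp.pos; positivity
  have ha' : (0 : ℝ) < a := by exact_mod_cast ha
  have hx0 : 0 < x := by
    rw [hx]; exact div_pos ha' (mul_pos hpd (by linarith))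
  have hc : ∀ n : ℕ, (seqS a (p ^ β) n : ℝ) / (p : ℝ) ^ (n * β + d) =
      x - x * ((p : ℝ) ^ β)⁻¹ ^ n := by
    intro n
    have h1 := seqS_eq a (p ^ β) n
    push_cast at h1
    have h2 : (p : ℝ) ^ β - 1 ≠ 0 := by linarith
    have h3 : (seqS a (p ^ β) n : ℝ) = a * (((p : ℝ) ^ β) ^ n - 1) / ((p : ℝ) ^ β - 1) := by
      rw [eq_div_iff h2, h1]
    rw [h3, hx, pow_add, mul_comm n β, pow_mul]
    have h4 : ((p : ℝ) ^ β) ^ n ≠ 0 := by positivity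
    have h5 := hpd.ne'
    rw [inv_pow]
    generalize ((p : ℝ) ^ β) ^ n = Q at *
    generalize (p : ℝ) ^ β = q at *
    field_simp
  have ht : ∀ n ≥ max n₀ 1, tau p (Ideal.span {g}) (x - x * ((p : ℝ) ^ β)⁻¹ ^ n) =
      Ie p (Ideal.span {g ^ seqS a (p ^ β) n₀}) (n₀ * β + d) := by
    intro n hn
    have hn1 : 1 ≤ n := (le_max_right _ _).trans hn
    rw [← hc, tau_eq p hp hS hC, h n ((le_max_left _ _).trans hn)]
    nlinarith [Nat.mul_le_mul hn1 hβ]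
  have hr0 : 0 < ((p : ℝ) ^ β)⁻¹ := by positivity
  have hr1 : ((p : ℝ) ^ β)⁻¹ < 1 := inv_lt_one_of_one_lt₀ hq1
  set r := ((p : ℝ) ^ β)⁻¹ with hr
  set N := max n₀ 1 with hN
  have key : ∀ c, x - x * r ^ N < c → c < x → tau p (Ideal.span {g}) c =
      Ie p (Ideal.span {g ^ seqS a (p ^ β) n₀}) (n₀ * β + d) := by
    intro c h1 h2
    obtain ⟨m, hm⟩ := exists_pow_lt_of_lt_one (div_pos (sub_pos.mpr h2) hx0) hr1
    apply le_antisymm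
    · rw [← ht N le_rfl]
      exact tau_anti p _ h1.le
    · rw [← ht (max N m) (le_max_left _ _)]
      apply tau_anti
      have h3 : r ^ max N m ≤ r ^ m := pow_le_pow_of_le_one hr0.le hr1.le (le_max_right _ _)
      have h4 := h3.trans_lt hm
      rw [lt_div_iff₀ hx0] at h4
      linarith
  exact ⟨x * r ^ N, by positivity, fun c c' h1 h2 h3 h4 => by rw [key c h1 h2, key c' h3 h4]⟩

theorem main_abs {R : Type*} [CommRing R] [IsNoetherianRing R] (p : ℕ) [ExpChar R p]
    (hp : p.Prime)
    (hS : ∀ (a : Ideal R) (e : ℕ), a ≤ (Ie p a e).map (iterateFrobenius R p e))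
    (hC : ∀ (e : ℕ) (I : Ideal R) (c : R),
      cln (I.map (iterateFrobenius R p e)) (iterateFrobenius R p e c) ≤
      (cln I c).map (iterateFrobenius R p e))
    (g : R) (a d β : ℕ) (hβ : 1 ≤ β) (x : ℝ)
    (hx : x = (a : ℝ) / ((p : ℝ) ^ d * ((p : ℝ) ^ β - 1))) :
    ¬ IsAccumulationPt {c : ℝ | IsFJumpingCoeff p (Ideal.span {g}) c} x := by
  intro hacc
  obtain ⟨δ, hδ, hright⟩ := right_const (tau p (Ideal.span {g})) (tau_anti p _) x
  have hleft : ∃ δ > 0, ∀ c c', 0 < c → x - δ < c → c < x → x - δ < c' → c' < x →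
      tau p (Ideal.span {g}) c = tau p (Ideal.span {g}) c' := by
    rcases Nat.eq_zero_or_pos a with rfl | ha
    · refine ⟨1, one_pos, fun c c' h0 _ h1 => ?_⟩
      simp at hx
      linarith
    · obtain ⟨δ, hδ, h⟩ := left_const p hp hS hC g a d β hβ ha x hx
      exact ⟨δ, hδ, fun c c' _ => h c c'⟩
  obtain ⟨δ', hδ', hleft⟩ := hleft
  have hx0 : 0 ≤ x := by
    have hq1 : (1 : ℝ) < (p : ℝ) ^ β :=
      one_lt_pow₀ (by exact_mod_cast hp.one_lt) (by omega)
    rw [hx]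
    exact div_nonneg (by positivity) (mul_nonneg (by positivity) (by linarith))
  obtain ⟨y, ⟨hy0, hy⟩, hne, hlt⟩ := hacc (min δ δ') (lt_min hδ hδ')
  rw [abs_lt] at hlt
  have h1 := min_le_left δ δ'
  have h2 := min_le_right δ δ'
  rcases lt_or_gt_of_ne hne with h | h
  · have h3 : 0 < min y (y - (x - δ')) := lt_min hy0 (by linarith)
    have h4 := min_le_left y (y - (x - δ'))
    have h5 := min_le_right y (y - (x - δ'))
    exact hy (min y (y - (x - δ')) / 2) (by linarith) (by linarith)
      (hleft _ _ hy0 (by linarith) h (by linarith) (by linarith))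
  · exact hy ((y - x) / 2) (by linarith) (by linarith)
      (hright _ _ h (by linarith) (by linarith) (by linarith))

end partF

end helpers

/-- The set of F-jumping coefficients of `g` has no accumulation point of the form
`a / (p^d (p^β - 1))` with `a, d, β ∈ ℕ`, `β ≥ 1`. -/
theorem stmt12 {R : Type*} [CommRing R] [IsNoetherianRing R] [IsLocalRing R]
    [IsAdicComplete (IsLocalRing.maximalIdeal R) R]
    (p : ℕ) (hp : p.Prime) [CharP R p]
    (hreg : IsRegularStmt R) (g : R) :
    ∀ a d β : ℕ, 1 ≤ β →
      ¬ IsAccumulationPt {c : ℝ | IsFJumpingCoeff p (Ideal.span {g}) c}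
        ((a : ℝ) / ((p : ℝ) ^ d * ((p : ℝ) ^ β - 1))) := by
  intro a d β hβ
  haveI : ExpChar R p := ExpChar.prime hp
  obtain ⟨s, hm, hd⟩ := hreg
  exact main_abs p hp (fun b e => star_all p s hm hd.le b e)
    (fun e I c => frob_cln p e s hm hd.le I c) g a d β hβ _ rfl
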